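/- (BQNL is patch test consistent.) For every F > 0, every N-periodic blending function η : ℤ → [0,1], and every u ∈ 𝒰, the first variation of the BQNL energy vanishes at the uniform deformation: δΦ^bqnl_η(y^F)[u] = 0. -/

import Mathlib

open scoped BigOperators ENNReal
open Finset

noncomputable section

/-- The lattice spacing `ε = 1/N`. -/
def eps (N : ℕ) : ℝ := (N : ℝ)⁻¹

/-- `u : ℤ → ℝ` is `N`-periodic. -/
def IsPeriodic (N : ℕ) (u : ℤ → ℝ) : Prop := ∀ ξ : ℤ, u (ξ + N) = u ξ

/-- Membership in the space `𝒰` of `N`-periodic mean-zero displacements. -/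
def inU (N : ℕ) (u : ℤ → ℝ) : Prop :=
  IsPeriodic N u ∧ ∑ ξ ∈ Finset.Icc (1 : ℤ) (N : ℤ), u ξ = 0

/-- The uniform deformation `y^F_ξ = F ε ξ`. -/
def yUnif (N : ℕ) (F : ℝ) : ℤ → ℝ := fun ξ => F * eps N * ξ

/-- Membership in the space `𝒴` of admissible deformations. -/
def inY (N : ℕ) (y : ℤ → ℝ) : Prop :=
  ∃ F : ℝ, 0 < F ∧ ∃ u : ℤ → ℝ, inU N u ∧ y = fun ξ => yUnif N F ξ + u ξ

/-- The discrete first derivative `y'_ξ = (y_ξ - y_{ξ-1})/ε`. -/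
def d1 (N : ℕ) (y : ℤ → ℝ) (ξ : ℤ) : ℝ := (y ξ - y (ξ - 1)) / eps N

/-- The discrete second derivative `y''_ξ`. -/
def d2 (N : ℕ) (y : ℤ → ℝ) (ξ : ℤ) : ℝ :=
  (y (ξ + 1) - 2 * y ξ + y (ξ - 1)) / (eps N) ^ 2

/-- The discrete third derivative `y'''_ξ`. -/
def d3 (N : ℕ) (y : ℤ → ℝ) (ξ : ℤ) : ℝ :=
  (y (ξ + 1) - 3 * y ξ + 3 * y (ξ - 1) - y (ξ - 2)) / (eps N) ^ 3

/-- The BQC energy `Φ_{α,β}`. -/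
def PhiBQC (N : ℕ) (φ : ℝ → ℝ) (α β : ℤ → ℝ) (y : ℤ → ℝ) : ℝ :=
  eps N * ∑ ξ ∈ Finset.Icc (1 : ℤ) (N : ℤ),
    (φ (d1 N y ξ) + α ξ * φ (2 * d1 N y ξ) + β ξ * φ (d1 N y ξ + d1 N y (ξ + 1)))

/-- The BQNL energy with blending function `η`. -/
def PhiBQNL (N : ℕ) (φ : ℝ → ℝ) (η : ℤ → ℝ) : (ℤ → ℝ) → ℝ :=
  PhiBQC N φ (fun ξ => 1 - (η ξ + η (ξ - 1)) / 2) η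

/-- The BQCE energy with blending function `γ`. -/
def PhiBQCE (N : ℕ) (φ : ℝ → ℝ) (γ : ℤ → ℝ) : (ℤ → ℝ) → ℝ :=
  PhiBQC N φ (fun ξ => (γ ξ + γ (ξ - 1)) / 2) (fun ξ => 1 - (γ (ξ + 1) + γ (ξ - 1)) / 2)

/-- The atomistic energy `Φ`. -/
def PhiAt (N : ℕ) (φ : ℝ → ℝ) (y : ℤ → ℝ) : ℝ :=
  eps N * ∑ ξ ∈ Finset.Icc (1 : ℤ) (N : ℤ),
    (φ (d1 N y ξ) + φ (d1 N y ξ + d1 N y (ξ + 1)))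

/-- The first variation `δΨ(y)[u] = (d/dt)|_{t=0} Ψ(y+tu)`. -/
def fvar (Ψ : (ℤ → ℝ) → ℝ) (y u : ℤ → ℝ) : ℝ :=
  deriv (fun t : ℝ => Ψ (fun ξ => y ξ + t * u ξ)) 0

/-- The second variation `δ²Ψ(y)[u,u] = (d²/dt²)|_{t=0} Ψ(y+tu)`. -/
def svar (Ψ : (ℤ → ℝ) → ℝ) (y u : ℤ → ℝ) : ℝ :=
  iteratedDeriv 2 (fun t : ℝ => Ψ (fun ξ => y ξ + t * u ξ)) 0

/-- `max_ξ |v_ξ|` (for a periodic sequence this is a genuine maximum). -/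
def supAbs (v : ℤ → ℝ) : ℝ := sSup (Set.range fun ξ => |v ξ|)

/-- `min_ξ y'_ξ` (for an admissible deformation this is a genuine minimum). -/
def infD1 (N : ℕ) (y : ℤ → ℝ) : ℝ := sInf (Set.range fun ξ => d1 N y ξ)

/-- The constant `C_i(r₀) = sup_{r ≥ r₀} |φ^(i)(r)|`. -/
def Cbound (φ : ℝ → ℝ) (i : ℕ) (r₀ : ℝ) : ℝ :=
  sSup ((fun r => |iteratedDeriv i φ r|) '' Set.Ici r₀)

/-- The `ℓ^p_ε` norm over one period, `p ∈ [1,∞]`. -/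
def lpnorm (N : ℕ) (p : ℝ≥0∞) (v : ℤ → ℝ) : ℝ :=
  if p = ⊤ then supAbs v
  else (eps N * ∑ ξ ∈ Finset.Icc (1 : ℤ) (N : ℤ), |v ξ| ^ p.toReal) ^ (1 / p.toReal)

/-- The Hessian coefficient `A_ξ` of the atomistic energy. -/
def Acoef (N : ℕ) (φ : ℝ → ℝ) (y : ℤ → ℝ) (ξ : ℤ) : ℝ :=
  iteratedDeriv 2 φ (d1 N y ξ) + 2 * iteratedDeriv 2 φ (d1 N y ξ + d1 N y (ξ + 1))
    + 2 * iteratedDeriv 2 φ (d1 N y (ξ - 1) + d1 N y ξ)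

/-- The Hessian coefficient `Ā_ξ` of the BQC energy. -/
def AbarCoef (N : ℕ) (φ : ℝ → ℝ) (α β : ℤ → ℝ) (y : ℤ → ℝ) (ξ : ℤ) : ℝ :=
  iteratedDeriv 2 φ (d1 N y ξ) + 2 * β ξ * iteratedDeriv 2 φ (d1 N y ξ + d1 N y (ξ + 1))
    + 2 * β (ξ - 1) * iteratedDeriv 2 φ (d1 N y (ξ - 1) + d1 N y ξ)
    + 4 * α ξ * iteratedDeriv 2 φ (2 * d1 N y ξ)

/-- The coercivity constant `inf { δ²Ψ(y)[u,u] : u ∈ 𝒰, ‖u'‖_{ℓ²_ε} = 1 }`. -/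
def coercConst (N : ℕ) (Ψ : (ℤ → ℝ) → ℝ) (y : ℤ → ℝ) : ℝ :=
  sInf { c : ℝ | ∃ u : ℤ → ℝ, inU N u ∧ lpnorm N 2 (d1 N u) = 1 ∧ c = svar Ψ y u }

end

/-- A sum of forward differences over `{1, …, n}` telescopes. -/
theorem sum_Icc_forward_difference (g : ℤ → ℝ) (n : ℕ) :
    ∑ ξ ∈ Finset.Icc (1 : ℤ) (n : ℤ), (g (ξ + 1) - g ξ) = g (n + 1) - g 1 := by
  induction n with
  | zero => simp
  | succ k ih =>
    have h : Finset.Icc (1 : ℤ) ((k + 1 : ℕ) : ℤ)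
        = insert ((k : ℤ) + 1) (Finset.Icc (1 : ℤ) (k : ℤ)) := by
      ext x
      simp only [Finset.mem_insert, Finset.mem_Icc]
      omega
    rw [h, Finset.sum_insert (by simp), ih]
    push_cast
    ring

/-- Over one period, the forward differences of a periodic function sum to zero. -/
theorem IsPeriodic.sum_forward_difference {N : ℕ} {g : ℤ → ℝ} (hg : IsPeriodic N g) :
    ∑ ξ ∈ Finset.Icc (1 : ℤ) (N : ℤ), (g (ξ + 1) - g ξ) = 0 := by
  rw [sum_Icc_forward_difference, add_comm (N : ℤ) 1, hg, sub_self]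

theorem IsPeriodic.d1 {N : ℕ} {u : ℤ → ℝ} (hu : IsPeriodic N u) : IsPeriodic N (d1 N u) := by
  intro ξ
  have h := hu (ξ - 1)
  rw [show ξ - 1 + (N : ℤ) = ξ + N - 1 by ring] at h
  simp only [_root_.d1, hu ξ, h]

theorem d1_yUnif_add_mul {N : ℕ} (hN : N ≠ 0) (F t : ℝ) (u : ℤ → ℝ) (ξ : ℤ) :
    d1 N (fun ζ => yUnif N F ζ + t * u ζ) ξ = F + t * d1 N u ξ := by
  have hN' : (N : ℝ) ≠ 0 := Nat.cast_ne_zero.mpr hN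
  simp only [d1, yUnif, eps]
  push_cast
  field_simp
  ring

/-- The first variation of the BQC energy at a uniform deformation. -/
theorem hasDerivAt_PhiBQC_yUnif {N : ℕ} (hN : N ≠ 0) {φ : ℝ → ℝ} {F : ℝ}
    (h₁ : DifferentiableAt ℝ φ F) (h₂ : DifferentiableAt ℝ φ (2 * F)) (α β u : ℤ → ℝ) :
    HasDerivAt (fun t : ℝ => PhiBQC N φ α β (fun ξ => yUnif N F ξ + t * u ξ))
      (eps N * ∑ ξ ∈ Finset.Icc (1 : ℤ) (N : ℤ),
        (deriv φ F * d1 N u ξ + α ξ * (deriv φ (2 * F) * (2 * d1 N u ξ))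
          + β ξ * (deriv φ (2 * F) * (d1 N u ξ + d1 N u (ξ + 1))))) 0 := by
  have affine (a b : ℝ) : HasDerivAt (fun t : ℝ => a + t * b) b 0 := by
    simpa using ((hasDerivAt_id (0 : ℝ)).mul_const b).const_add a
  have comp_affine {a : ℝ} (ha : DifferentiableAt ℝ φ a) (b : ℝ) :
      HasDerivAt (fun t : ℝ => φ (a + t * b)) (deriv φ a * b) 0 :=
    HasDerivAt.comp (h₂ := φ) 0 (by simpa using ha.hasDerivAt) (affine a b)
  simp only [PhiBQC, d1_yUnif_add_mul hN]
  refine (HasDerivAt.fun_sum fun ξ _ => ?_).const_mul _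
  refine ((comp_affine h₁ _).add (HasDerivAt.const_mul _ ?_)).add (HasDerivAt.const_mul _ ?_)
  · have h (t : ℝ) : 2 * (F + t * d1 N u ξ) = 2 * F + t * (2 * d1 N u ξ) := by ring
    simpa only [h] using comp_affine h₂ (2 * d1 N u ξ)
  · have h (t : ℝ) : F + t * d1 N u ξ + (F + t * d1 N u (ξ + 1))
        = 2 * F + t * (d1 N u ξ + d1 N u (ξ + 1)) := by ring
    simpa only [h] using comp_affine h₂ (d1 N u ξ + d1 N u (ξ + 1))

/-- BQNL is patch test consistent. -/
theorem bqnl_patch_test_consistent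
    (N : ℕ) (hN : 5 ≤ N) (φ : ℝ → ℝ) (hφ : ContDiffOn ℝ 4 φ (Set.Ioi 0))
    (F : ℝ) (hF : 0 < F)
    (η : ℤ → ℝ) (hηper : IsPeriodic N η) (hη01 : ∀ ξ, η ξ ∈ Set.Icc (0 : ℝ) 1)
    (u : ℤ → ℝ) (hu : inU N u) :
    fvar (PhiBQNL N φ η) (yUnif N F) u = 0 := by
  have hdiff : ∀ x : ℝ, 0 < x → DifferentiableAt ℝ φ x := fun x hx =>
    (hφ.contDiffAt (Ioi_mem_nhds hx)).differentiableAt (by norm_num)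
  have hd := hu.1.d1
  rw [fvar, PhiBQNL, (hasDerivAt_PhiBQC_yUnif (by omega) (hdiff F hF)
    (hdiff (2 * F) (by positivity)) _ _ u).deriv]
  let g : ℤ → ℝ := fun ξ => (deriv φ F + 2 * deriv φ (2 * F)) * (u (ξ - 1) / eps N)
    + deriv φ (2 * F) * (η (ξ - 1) * d1 N u ξ)
  have hg : IsPeriodic N g := by
    intro ξ
    simp only [g, show ξ + (N : ℤ) - 1 = ξ - 1 + N by ring, hu.1 (ξ - 1), hηper (ξ - 1), hd ξ]
  rw [← mul_zero (eps N), ← hg.sum_forward_difference]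
  congr 1
  refine Finset.sum_congr rfl fun ξ _ => ?_
  have hdξ : d1 N u ξ = u ξ / eps N - u (ξ - 1) / eps N := sub_div _ _ _
  simp only [g, add_sub_cancel_right]
  linear_combination (deriv φ F + 2 * deriv φ (2 * F)) * hdξ
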